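/- arXiv:0709.0715 — 3 statements merged into one kernel-verified Lean document; each statement's English description precedes it below -/
import Mathlib

section
/- Let k be a field, V a finite-dimensional k-vector space, and G ≤ GL(V) a finite group, and let H be the point stabilizer of a linear subspace U ⊆ V, i.e. H = {g ∈ G : g·u = u for all u ∈ U}. If the action of G on V has the direct summand property, then the action of H on V also has the direct summand property. -/
open MvPolynomial Matrix

set_option synthInstance.maxHeartbeats 1000000
set_option maxHeartbeats 1000000

variable {k : Type} [Field k] {ι : Type} [Fintype ι] [DecidableEq ι]

/-- Substitution of the variables by the linear forms determined by the matrix `g`. -/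
noncomputable def polySub (g : Matrix ι ι k) :
    MvPolynomial ι k →ₐ[k] MvPolynomial ι k :=
  aeval fun i => ∑ j, C (g i j) * X j

/-- The (left) action of an invertible matrix `g` on polynomial functions,
`(g • f)(v) = f (g⁻¹ *ᵥ v)`. -/
noncomputable def polyAct (g : Matrix ι ι k) :
    MvPolynomial ι k →ₐ[k] MvPolynomial ι k :=
  polySub g⁻¹

/-- The ring of invariants of a set of (invertible) matrices. -/
noncomputable def invariantRing (S : Set (Matrix ι ι k)) :
    Subalgebra k (MvPolynomial ι k) :=
  ⨅ g ∈ S, AlgHom.equalizer (polyAct g) (AlgHom.id k _)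

/-- The direct summand property: there is a surjective `k[V]^G`-linear map
`k[V] → k[V]^G` respecting the gradings. -/
noncomputable def DirectSummand (S : Set (Matrix ι ι k)) : Prop :=
  ∃ π : MvPolynomial ι k →ₗ[invariantRing S] invariantRing S,
    Function.Surjective π ∧
    ∀ (d : ℕ) (f : MvPolynomial ι k),
      f.IsHomogeneous d → ((π f : MvPolynomial ι k)).IsHomogeneous d

/-- Coregularity: the invariant ring is generated by `dim V` algebraically
independent homogeneous invariants. -/
noncomputable def Coregular (S : Set (Matrix ι ι k)) : Prop :=
  ∃ f : ι → MvPolynomial ι k,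
    (∀ i, ∃ d, (f i).IsHomogeneous d) ∧
    AlgebraicIndependent k f ∧
    Algebra.adjoin k (Set.range f) = invariantRing S

/-- A pseudo-reflection: fixed-point space of codimension one. -/
def IsPseudoReflection (g : Matrix ι ι k) : Prop :=
  Module.finrank k (LinearMap.ker (g.mulVecLin - LinearMap.id)) + 1 = Fintype.card ι

/-- The set of matrices underlying a subgroup of `GL`. -/
def matSet {n : ℕ} (G : Subgroup (GL (Fin n) k)) : Set (Matrix (Fin n) (Fin n) k) :=
  (fun g : GL (Fin n) k => (g : Matrix (Fin n) (Fin n) k)) '' (G : Set (GL (Fin n) k))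

/-- The point stabilizer of a subspace `U`. -/
def pointStabilizer {n : ℕ} (G : Subgroup (GL (Fin n) k)) (U : Submodule k (Fin n → k)) :
    Subgroup (GL (Fin n) k) where
  carrier := {g | g ∈ G ∧ ∀ u ∈ U, (g : Matrix (Fin n) (Fin n) k) *ᵥ u = u}
  one_mem' := ⟨G.one_mem, fun u _ => by simp⟩
  mul_mem' := fun {a b} ha hb => ⟨G.mul_mem ha.1 hb.1, fun u hu => by
    have h1 := ha.2 u hu
    have h2 := hb.2 u hu
    rw [Units.val_mul, ← Matrix.mulVec_mulVec, h2, h1]⟩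
  inv_mem' := fun {a} ha => ⟨G.inv_mem ha.1, fun u hu => by
    conv_lhs => rw [← ha.2 u hu]
    rw [Matrix.mulVec_mulVec, Units.inv_mul, Matrix.one_mulVec]⟩

section FiniteGroupAction

variable {Γ A : Type} [Group Γ] [CommRing A] [MulSemiringAction Γ A]

/-- Elements moved modulo `P` can be replaced by `H`-invariant ones when `H` acts trivially
modulo the prime `P`. -/
lemma exists_invariant_smul_sub_notMem [Finite Γ] (H : Subgroup Γ) (P : Ideal A) [P.IsPrime]
    (hH : ∀ h ∈ H, ∀ a : A, h • a - a ∈ P) (g : Γ) (y : A) (hy : g • y - y ∉ P) :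
    ∃ c : A, (∀ h ∈ H, h • c = c) ∧ g • c - c ∉ P := by
  classical
  have := Fintype.ofFinite H
  by_contra! hc
  set p := MulSemiringAction.charpoly H y with hp
  have hcoeff (j : ℕ) : g • p.coeff j - p.coeff j ∈ P :=
    hc _ fun h hh => MulSemiringAction.smul_coeff_charpoly y j (⟨h, hh⟩ : H)
  have hzero : (g • p).eval (g • y) = 0 := by
    rw [Polynomial.smul_eval_smul, hp, MulSemiringAction.eval_charpoly, smul_zero]
  have hmem : p.eval (g • y) ∈ P := by
    have hsub : (g • p - p).eval (g • y) ∈ P := by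
      rw [Polynomial.eval_eq_sum_range]
      refine P.sum_mem fun j _ => P.mul_mem_right _ ?_
      simpa using hcoeff j
    rw [Polynomial.eval_sub, hzero, zero_sub] at hsub
    simpa using P.neg_mem hsub
  rw [hp, MulSemiringAction.charpoly_eq, Polynomial.eval_prod] at hmem
  obtain ⟨h, -, hh⟩ := (Ideal.IsPrime.prod_mem_iff).1 hmem
  simp only [Polynomial.eval_sub, Polynomial.eval_X, Polynomial.eval_C] at hh
  apply hy
  rw [← sub_add_sub_cancel (g • y) (h • y) y]
  exact P.add_mem hh (hH h h.2 y)

/-- Elements outside `H` are separated from the identity by an element of `A^H ⊗ A^H`. -/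
lemma exists_separating_pair [Finite Γ] (H : Subgroup Γ) (P : Ideal A) [P.IsPrime]
    (hH : ∀ h ∈ H, ∀ a : A, h • a - a ∈ P) (g : Γ) (y : A) (hy : g • y - y ∉ P) :
    ∃ (m : ℕ) (u v : Fin m → A), (∀ j, ∀ h ∈ H, h • u j = u j) ∧ (∀ j, ∀ h ∈ H, h • v j = v j) ∧
      ∑ j, u j * g • v j = 0 ∧ ∑ j, u j * v j ∉ P := by
  classical
  have := Fintype.ofFinite H
  obtain ⟨c, hc, hgc⟩ := exists_invariant_smul_sub_notMem H P hH g y hy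
  set p := MulSemiringAction.charpoly H (g • c) with hp
  refine ⟨p.natDegree + 1, fun j => p.coeff j, fun j => c ^ (j : ℕ), fun j h hh =>
    MulSemiringAction.smul_coeff_charpoly (g • c) j (⟨h, hh⟩ : H),
    fun j h hh => by rw [smul_pow', hc h hh], ?_, ?_⟩
  · rw [Fin.sum_univ_eq_sum_range (fun j => p.coeff j * g • c ^ j)]
    simp_rw [smul_pow']
    rw [← Polynomial.eval_eq_sum_range, hp, MulSemiringAction.eval_charpoly]
  · rw [Fin.sum_univ_eq_sum_range (fun j => p.coeff j * c ^ j), ← Polynomial.eval_eq_sum_range,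
      hp, MulSemiringAction.charpoly_eq, Polynomial.eval_prod]
    intro hmem
    obtain ⟨h, -, hh⟩ := (Ideal.IsPrime.prod_mem_iff).1 hmem
    simp only [Polynomial.eval_sub, Polynomial.eval_X, Polynomial.eval_C] at hh
    apply hgc
    rw [← neg_sub, P.neg_mem_iff, ← sub_add_sub_cancel c (h • g • c) (g • c)]
    exact P.add_mem hh (hH h h.2 (g • c))

/-- An element of `A^H ⊗ A^H` vanishing off `H` whose value at the identity is not in `P`. -/
lemma exists_separating_family [Finite Γ] (H : Subgroup Γ) (P : Ideal A) [P.IsPrime]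
    (hH : ∀ h ∈ H, ∀ a : A, h • a - a ∈ P) (hP : ∀ g ∉ H, ∃ y : A, g • y - y ∉ P) :
    ∃ (J : Type) (_ : Fintype J) (u v : J → A),
      (∀ j, ∀ h ∈ H, h • u j = u j) ∧ (∀ j, ∀ h ∈ H, h • v j = v j) ∧
      (∀ g ∉ H, ∑ j, u j * g • v j = 0) ∧ ∑ j, u j * v j ∉ P := by
  classical
  have := Fintype.ofFinite Γ
  suffices key : ∀ s : Finset Γ, (∀ g ∈ s, g ∉ H) → ∃ (J : Type) (_ : Fintype J) (u v : J → A),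
      (∀ j, ∀ h ∈ H, h • u j = u j) ∧ (∀ j, ∀ h ∈ H, h • v j = v j) ∧
      (∀ g ∈ s, ∑ j, u j * g • v j = 0) ∧ ∑ j, u j * v j ∉ P by
    obtain ⟨J, hJ, u, v, hu, hv, h0, h1⟩ := key {g | g ∉ H} (by simp)
    exact ⟨J, hJ, u, v, hu, hv, fun g hg => h0 g (by simpa using hg), h1⟩
  intro s
  induction s using Finset.induction_on with
  | empty =>
    intro _
    refine ⟨Unit, inferInstance, fun _ => 1, fun _ => 1, by simp, by simp, by simp, ?_⟩
    simpa using (Ideal.ne_top_iff_one P).1 Ideal.IsPrime.ne_top'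
  | insert g s _ ih =>
    intro hs
    obtain ⟨J, hJ, u, v, hu, hv, h0, h1⟩ := ih fun g' hg' => hs g' (Finset.mem_insert_of_mem hg')
    obtain ⟨y, hy⟩ := hP g (hs g (Finset.mem_insert_self g s))
    obtain ⟨m, u', v', hu', hv', h0', h1'⟩ := exists_separating_pair H P hH g y hy
    have hmul (f : A → A) (hf : ∀ a b, f (a * b) = f a * f b) :
        ∑ j : J × Fin m, u j.1 * u' j.2 * f (v j.1 * v' j.2) =
          (∑ j, u j * f (v j)) * ∑ j, u' j * f (v' j) := by
      rw [Fintype.sum_mul_sum, Fintype.sum_prod_type]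
      exact Finset.sum_congr rfl fun i _ => Finset.sum_congr rfl fun j _ => by rw [hf]; ring
    refine ⟨J × Fin m, inferInstance, fun j => u j.1 * u' j.2, fun j => v j.1 * v' j.2,
      fun j h hh => by rw [smul_mul', hu _ h hh, hu' _ h hh],
      fun j h hh => by rw [smul_mul', hv _ h hh, hv' _ h hh], fun g' hg' => ?_, ?_⟩
    · rw [hmul _ (smul_mul' g')]
      rcases Finset.mem_insert.1 hg' with rfl | hg'
      · rw [h0', mul_zero]
      · rw [h0 g' hg', zero_mul]
    · intro h
      have hid := hmul id fun _ _ => rfl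
      simp only [id] at hid
      rw [hid] at h
      exact (Ideal.IsPrime.mem_or_mem ‹_› h).elim h1 h1'

lemma smul_sum_smul_eq [Fintype Γ] (h : Γ) (a : A) : h • ∑ g : Γ, g • a = ∑ g : Γ, g • a := by
  rw [Finset.smul_sum]
  simp_rw [smul_smul]
  exact Equiv.sum_comp (Equiv.mulLeft h) fun g : Γ => g • a

/-- Galois descent for a faithful action on a domain: a tensor all of whose conjugate
contractions vanish is killed by every map linear over the invariants. -/
lemma sum_mul_map_eq_zero [Finite Γ] [IsDomain A] (hfaith : ∀ g : Γ, g ≠ 1 → ∃ y : A, g • y ≠ y)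
    (φ : A →+ A) (hφ : ∀ b a : A, (∀ g : Γ, g • b = b) → φ (b * a) = b * φ a)
    {J : Type} [Fintype J] (u v : J → A) (huv : ∀ g : Γ, ∑ j, u j * g • v j = 0) :
    ∑ j, u j * φ (v j) = 0 := by
  classical
  have := Fintype.ofFinite Γ
  obtain ⟨L, _, z, w, -, -, h0, h1⟩ := exists_separating_family (⊥ : Subgroup Γ) (⊥ : Ideal A)
    (by simp) fun g hg => by
      obtain ⟨y, hy⟩ := hfaith g (by simpa using hg)
      exact ⟨y, by simpa [sub_eq_zero] using hy⟩
  set d := ∑ l, z l * w l with hd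
  replace h1 : d ≠ 0 := by simpa using h1
  have hdesc (a : A) : d * a = ∑ l, w l * ∑ g : Γ, g • (z l * a) := by
    simp_rw [Finset.mul_sum]
    rw [Finset.sum_comm, Finset.sum_eq_single (1 : Γ)]
    · simp_rw [hd, Finset.sum_mul, one_smul]
      exact Finset.sum_congr rfl fun l _ => by ring
    · intro g _ hg
      have h := congrArg (g • ·) (h0 g⁻¹ (by simpa using hg))
      simp only [Finset.smul_sum, smul_mul', smul_inv_smul, smul_zero] at h
      calc ∑ l, w l * g • (z l * a) = (∑ l, g • z l * w l) * g • a := by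
            rw [Finset.sum_mul]
            exact Finset.sum_congr rfl fun l _ => by rw [smul_mul']; ring
        _ = 0 := by rw [h, zero_mul]
    · simp
  set e := ∏ g ∈ Finset.univ.erase (1 : Γ), g • d with he
  have hN : e * d = ∏ g : Γ, g • d := by
    rw [he, ← Finset.prod_erase_mul Finset.univ _ (Finset.mem_univ (1 : Γ)), one_smul]
  have hNinv (h : Γ) : h • (e * d) = e * d := by
    rw [hN, Finset.smul_prod_perm]
  have hN0 : e * d ≠ 0 := by
    rw [hN, Finset.prod_ne_zero_iff]
    exact fun g _ => (smul_ne_zero_iff_ne g).2 h1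
  have hφN (a : A) : e * d * φ a = ∑ l, (∑ g : Γ, g • (z l * (e * a))) * φ (w l) := by
    rw [← hφ _ _ hNinv, show e * d * a = d * (e * a) by ring, hdesc, map_sum]
    exact Finset.sum_congr rfl fun l _ => by
      rw [mul_comm, hφ _ _ fun h => smul_sum_smul_eq h _]
  refine (mul_eq_zero.1 ?_).resolve_left hN0
  calc e * d * ∑ j, u j * φ (v j)
      = ∑ j, ∑ l, ∑ g : Γ, g • (z l * e) * φ (w l) * (u j * g • v j) := by
        rw [Finset.mul_sum]
        refine Finset.sum_congr rfl fun j _ => ?_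
        rw [mul_left_comm, hφN, Finset.mul_sum]
        refine Finset.sum_congr rfl fun l _ => ?_
        rw [Finset.sum_mul, Finset.mul_sum]
        refine Finset.sum_congr rfl fun g _ => ?_
        rw [← mul_assoc (z l), smul_mul' g (z l * e)]
        ring
    _ = 0 := by
        rw [Finset.sum_comm]
        refine Finset.sum_eq_zero fun l _ => ?_
        rw [Finset.sum_comm]
        refine Finset.sum_eq_zero fun g _ => ?_
        rw [← Finset.mul_sum, huv, mul_zero]

/-- A retraction onto the invariants of `Γ` yields a map to the invariants of the inertia group `H`
of a prime `P`, linear over these invariants and with value at `1` outside `P`. -/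
lemma exists_linear_map_one_notMem [Finite Γ] [IsDomain A]
    (hfaith : ∀ g : Γ, g ≠ 1 → ∃ y : A, g • y ≠ y) (H : Subgroup Γ) (P : Ideal A) [P.IsPrime]
    (hH : ∀ h ∈ H, ∀ a : A, h • a - a ∈ P) (hP : ∀ g ∉ H, ∃ y : A, g • y - y ∉ P)
    (φ : A →+ A) (hφ : ∀ b a : A, (∀ g : Γ, g • b = b) → φ (b * a) = b * φ a)
    (hφinv : ∀ (a : A) (g : Γ), g • φ a = φ a) (hφ1 : φ 1 = 1) :
    ∃ ψ : A →+ A, (∀ c a : A, (∀ h ∈ H, h • c = c) → ψ (c * a) = c * ψ a) ∧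
      (∀ (a : A), ∀ h ∈ H, h • ψ a = ψ a) ∧ ψ 1 ∉ P := by
  classical
  have := Fintype.ofFinite Γ
  obtain ⟨J, _, u, v, hu, hv, h0, h1⟩ := exists_separating_family H P hH hP
  let ψ : A →+ A := ∑ r : Γ ⧸ H, ∑ j, (AddMonoidHom.mulLeft (u j)).comp
    (φ.comp ((DistribSMul.toAddMonoidHom A r.out).comp (AddMonoidHom.mulLeft (v j))))
  have hψ (a : A) : ψ a = ∑ r : Γ ⧸ H, ∑ j, u j * φ (r.out • (v j * a)) := by
    simp [ψ]
  refine ⟨ψ, fun c a hc => ?_, fun a h hh => ?_, ?_⟩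
  · rw [hψ, hψ, Finset.mul_sum]
    refine Finset.sum_congr rfl fun r _ => ?_
    let φr : A →+ A := φ.comp ((DistribSMul.toAddMonoidHom A r.out).comp (AddMonoidHom.mulRight a))
    have hφr (b : A) : φr b = φ (r.out • (b * a)) := rfl
    have key := sum_mul_map_eq_zero (Γ := Γ) hfaith φr (fun b x hb => by
        rw [hφr, hφr, mul_assoc, smul_mul', hb, hφ _ _ hb])
      (J := J ⊕ J) (Sum.elim u fun j => -(c * u j)) (Sum.elim (fun j => v j * c) v) fun g => by
        simp only [Fintype.sum_sum_type, Sum.elim_inl, Sum.elim_inr]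
        have hsplit : ∑ j, u j * g • (v j * c) + ∑ j, -(c * u j) * g • v j =
            (g • c - c) * ∑ j, u j * g • v j := by
          rw [Finset.mul_sum, ← Finset.sum_add_distrib]
          exact Finset.sum_congr rfl fun j _ => by rw [smul_mul']; ring
        rw [hsplit]
        by_cases hg : g ∈ H
        · rw [hc g hg, sub_self, zero_mul]
        · rw [h0 g hg, mul_zero]
    simp only [Fintype.sum_sum_type, Sum.elim_inl, Sum.elim_inr, hφr, neg_mul,
      Finset.sum_neg_distrib, add_neg_eq_zero, mul_assoc] at key
    rw [key, Finset.mul_sum]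
  · rw [hψ, Finset.smul_sum]
    refine Finset.sum_congr rfl fun r _ => ?_
    rw [Finset.smul_sum]
    exact Finset.sum_congr rfl fun j _ => by rw [smul_mul', hu j h hh, hφinv]
  · have htr (j : J) (g : Γ) : g • ∑ r : Γ ⧸ H, r.out • v j = ∑ r : Γ ⧸ H, r.out • v j := by
      have hout (x : Γ) : (x : Γ ⧸ H).out • v j = x • v j := by
        obtain ⟨h, hh⟩ := QuotientGroup.mk_out_eq_mul H x
        rw [hh, mul_smul, hv j h h.2]
      rw [Finset.smul_sum, ← Equiv.sum_comp (MulAction.toPerm g) fun r : Γ ⧸ H => r.out • v j]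
      refine Finset.sum_congr rfl fun r _ => ?_
      induction r using QuotientGroup.induction_on with
      | H x =>
        rw [hout, MulAction.toPerm_apply, MulAction.Quotient.smul_coe, hout, smul_smul, smul_eq_mul]
    have hval : ψ 1 = ∑ j, u j * v j := by
      calc ψ 1 = ∑ j, u j * φ ((∑ r : Γ ⧸ H, r.out • v j) * 1) := by
            rw [hψ, Finset.sum_comm]
            simp [Finset.mul_sum]
        _ = ∑ r : Γ ⧸ H, ∑ j, u j * r.out • v j := by
            rw [Finset.sum_comm]
            refine Finset.sum_congr rfl fun j _ => ?_
            rw [hφ _ _ (htr j), hφ1, mul_one, Finset.mul_sum]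
        _ = ∑ j, u j * (((1 : Γ) : Γ ⧸ H).out • v j) := by
            refine Finset.sum_eq_single _ (fun r _ hr => h0 _ fun hmem => hr ?_) (by simp)
            rw [← r.out_eq']
            exact QuotientGroup.eq.2 (by simpa using hmem)
        _ = ∑ j, u j * v j := by
            obtain ⟨h, hh⟩ := QuotientGroup.mk_out_eq_mul H 1
            rw [hh]
            exact Finset.sum_congr rfl fun j _ => by rw [one_mul, hv j h h.2]
    rwa [hval]

end FiniteGroupAction

set_option linter.unusedSectionVars false

section MatrixAction

lemma polySub_X (g : Matrix ι ι k) (i : ι) : polySub g (X i) = ∑ j, C (g i j) * X j := by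
  simp [polySub]

lemma polySub_polySub (g h : Matrix ι ι k) (f : MvPolynomial ι k) :
    polySub g (polySub h f) = polySub (h * g) f := by
  suffices (polySub g).comp (polySub h) = polySub (h * g) from DFunLike.congr_fun this f
  ext1 i
  simp only [AlgHom.comp_apply, polySub_X, map_sum, map_mul, Matrix.mul_apply, Finset.sum_mul,
    Finset.mul_sum, algHom_C, algebraMap_eq]
  rw [Finset.sum_comm]
  exact Finset.sum_congr rfl fun _ _ => Finset.sum_congr rfl fun _ _ => by ring

lemma polySub_one (f : MvPolynomial ι k) : polySub (1 : Matrix ι ι k) f = f := by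
  suffices polySub (1 : Matrix ι ι k) = AlgHom.id k _ from DFunLike.congr_fun this f
  ext1 i
  simp [polySub_X, Matrix.one_apply, apply_ite C, ite_mul]

lemma polySub_injective : Function.Injective (polySub : Matrix ι ι k → _) := by
  intro g h hgh
  ext i j
  have hX := congrArg (coeff (Finsupp.single j 1)) (DFunLike.congr_fun hgh (X i))
  simpa [polySub_X, coeff_sum, coeff_C_mul, coeff_X, Finsupp.single_left_inj] using hX

lemma MvPolynomial.IsHomogeneous.polySub {f : MvPolynomial ι k} {d : ℕ} (hf : f.IsHomogeneous d)
    (g : Matrix ι ι k) : (polySub g f).IsHomogeneous d := by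
  have hlin (i : ι) : (∑ j, C (g i j) * X j : MvPolynomial ι k).IsHomogeneous 1 :=
    IsHomogeneous.sum _ _ _ fun j _ => isHomogeneous_C_mul_X _ _
  simpa [_root_.polySub] using hf.aeval _ hlin

lemma homogeneousComponent_polySub (g : Matrix ι ι k) (d : ℕ) (f : MvPolynomial ι k) :
    homogeneousComponent d (polySub g f) = polySub g (homogeneousComponent d f) := by
  conv_lhs => rw [← sum_homogeneousComponent f]
  rw [map_sum, map_sum]
  simp_rw [homogeneousComponent_of_mem ((homogeneousComponent_isHomogeneous _ f).polySub g)]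
  rw [Finset.sum_ite_eq]
  split_ifs with hd
  · rfl
  · rw [homogeneousComponent_eq_zero, map_zero]
    simpa [Nat.lt_succ_iff] using hd

lemma mem_invariantRing {S : Set (Matrix ι ι k)} {f : MvPolynomial ι k} :
    f ∈ invariantRing S ↔ ∀ g ∈ S, polyAct g f = f := by
  simp [invariantRing, Algebra.mem_iInf, AlgHom.mem_equalizer]

lemma homogeneousComponent_mem_invariantRing {S : Set (Matrix ι ι k)} {f : MvPolynomial ι k}
    (hf : f ∈ invariantRing S) (d : ℕ) : homogeneousComponent d f ∈ invariantRing S := by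
  rw [mem_invariantRing] at hf ⊢
  intro g hg
  rw [polyAct, ← homogeneousComponent_polySub, ← polyAct, hf g hg]

lemma homogeneousComponent_add_mul {c : MvPolynomial ι k} {e : ℕ} (hc : c.IsHomogeneous e) (d : ℕ)
    (f : MvPolynomial ι k) :
    homogeneousComponent (e + d) (c * f) = c * homogeneousComponent d f := by
  conv_lhs => rw [← sum_homogeneousComponent f]
  rw [Finset.mul_sum, map_sum]
  simp_rw [homogeneousComponent_of_mem (hc.mul (homogeneousComponent_isHomogeneous _ f)),
    add_right_inj]
  rw [Finset.sum_ite_eq]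
  split_ifs with hd
  · rfl
  · rw [homogeneousComponent_eq_zero d f, mul_zero]
    simpa [Nat.lt_succ_iff] using hd

/-- The degree-zero part of a linear map to the invariants gives the direct summand property as
soon as the constant coefficient of its value at `1` does not vanish. -/
lemma directSummand_of_constantCoeff_ne_zero (S : Set (Matrix ι ι k))
    (ψ : MvPolynomial ι k →+ MvPolynomial ι k)
    (hψ : ∀ c ∈ invariantRing S, ∀ a, ψ (c * a) = c * ψ a)
    (hmem : ∀ a, ψ a ∈ invariantRing S) (h1 : constantCoeff (ψ 1) ≠ 0) : DirectSummand S := by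
  let ψk : MvPolynomial ι k →ₗ[k] MvPolynomial ι k :=
    { ψ with
      map_smul' := fun r a => by
        simp only [RingHom.id_apply, smul_eq_C_mul]
        exact hψ _ ((invariantRing S).algebraMap_mem r) a }
  let π : MvPolynomial ι k →ₗ[k] MvPolynomial ι k :=
    (basisMonomials ι k).constr k fun m => homogeneousComponent m.degree (ψk (monomial m 1))
  have hπmon (m : ι →₀ ℕ) (r : k) :
      π (monomial m r) = homogeneousComponent m.degree (ψk (monomial m r)) := by
    have hm : monomial m r = r • basisMonomials ι k m := by simp [smul_monomial]
    rw [hm, map_smul, Module.Basis.constr_basis, map_smul, map_smul, coe_basisMonomials]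
  have hπ (d : ℕ) (f : MvPolynomial ι k) (hf : f.IsHomogeneous d) :
      π f = homogeneousComponent d (ψ f) := by
    change π f = homogeneousComponent d (ψk f)
    conv_lhs => rw [f.as_sum]
    conv_rhs => rw [f.as_sum]
    simp only [map_sum]
    refine Finset.sum_congr rfl fun m hm => ?_
    have hm : m.degree = d := by
      rw [Finsupp.degree_eq_weight_one]
      exact hf (mem_support_iff.1 hm)
    rw [hπmon, hm]
  have hπsum (f : MvPolynomial ι k) : π f =
      ∑ d ∈ Finset.range (f.totalDegree + 1),
        homogeneousComponent d (ψ (homogeneousComponent d f)) := by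
    conv_lhs => rw [← sum_homogeneousComponent f, map_sum]
    exact Finset.sum_congr rfl fun d _ => hπ d _ (homogeneousComponent_isHomogeneous d f)
  have hπmem (f : MvPolynomial ι k) : π f ∈ invariantRing S := by
    rw [hπsum]
    exact sum_mem fun d _ => homogeneousComponent_mem_invariantRing (hmem _) d
  have hπmul (c : MvPolynomial ι k) (hc : c ∈ invariantRing S) (f : MvPolynomial ι k) :
      π (c * f) = c * π f := by
    rw [hπsum f]
    conv_lhs => rw [← sum_homogeneousComponent c, ← sum_homogeneousComponent f]
    conv_rhs => rw [← sum_homogeneousComponent c]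
    rw [Finset.sum_mul_sum, Finset.sum_mul_sum, map_sum]
    refine Finset.sum_congr rfl fun e _ => ?_
    rw [map_sum]
    refine Finset.sum_congr rfl fun d _ => ?_
    have he := homogeneousComponent_isHomogeneous e c
    rw [hπ _ _ (he.mul (homogeneousComponent_isHomogeneous d f)),
      hψ _ (homogeneousComponent_mem_invariantRing hc e), homogeneousComponent_add_mul he]
  refine ⟨{ toFun := fun f => ⟨π f, hπmem f⟩
            map_add' := fun f f' => Subtype.ext (map_add π f f')
            map_smul' := fun c f => Subtype.ext (hπmul c c.2 f) }, fun c => ?_, fun d f hf => ?_⟩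
  · set r := constantCoeff (ψ 1) with hr
    have hπ1 : π 1 = C r := by
      rw [hπ 0 1 (isHomogeneous_one ι k), homogeneousComponent_zero, hr, constantCoeff_eq]
    refine ⟨(c : MvPolynomial ι k) * C r⁻¹, Subtype.ext ?_⟩
    have hmem' : (c : MvPolynomial ι k) * C r⁻¹ ∈ invariantRing S :=
      mul_mem c.2 ((invariantRing S).algebraMap_mem r⁻¹)
    change π ((c : MvPolynomial ι k) * C r⁻¹) = c
    rw [← mul_one ((c : MvPolynomial ι k) * C r⁻¹), hπmul _ hmem', hπ1, mul_assoc, ← C_mul,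
      inv_mul_cancel₀ h1, C_1, mul_one]
  · change (π f).IsHomogeneous d
    rw [hπ d f hf]
    exact homogeneousComponent_isHomogeneous d _

end MatrixAction

section Translation

/-- The generic translation along the column space of `M`. -/
noncomputable def genericTranslation (M : Matrix ι ι k) :
    MvPolynomial ι k →+* MvPolynomial ι (MvPolynomial ι k) :=
  eval₂Hom (C.comp C) fun i => C (X i) + ∑ j, C (C (M i j)) * X j

lemma genericTranslation_C (M : Matrix ι ι k) (r : k) : genericTranslation M (C r) = C (C r) := by
  rw [genericTranslation, eval₂Hom_C, RingHom.comp_apply]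

lemma genericTranslation_X (M : Matrix ι ι k) (i : ι) :
    genericTranslation M (X i) = C (X i) + ∑ j, C (C (M i j)) * X j := by
  rw [genericTranslation, eval₂Hom_X']

lemma polySub_C (g : Matrix ι ι k) (r : k) : polySub g (C r) = C r := algHom_C _ r

lemma map_polySub_genericTranslation {M g : Matrix ι ι k} (hg : g * M = M)
    (f : MvPolynomial ι k) :
    MvPolynomial.map (polySub g).toRingHom (genericTranslation M f) =
      genericTranslation M (polySub g f) := by
  induction f using MvPolynomial.induction_on with
  | C r =>
    rw [polySub_C, genericTranslation_C, map_C, AlgHom.toRingHom_eq_coe, RingHom.coe_coe, polySub_C]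
  | add p q hp hq => rw [map_add, map_add, hp, hq, map_add, map_add]
  | mul_X p i hp =>
    rw [map_mul, map_mul, hp, map_mul, map_mul]
    refine congrArg (_ * ·) ?_
    have hM (l : ι) : M i l = ∑ j, g i j * M j l := by rw [← Matrix.mul_apply, hg]
    simp only [genericTranslation_X, genericTranslation_C, polySub_X, AlgHom.toRingHom_eq_coe,
      RingHom.coe_coe, map_add, map_sum, map_mul, map_C, map_X, polySub_C,
      mul_add, Finset.sum_add_distrib, Finset.mul_sum]
    refine congrArg (_ + ·) ?_
    rw [Finset.sum_comm]
    refine Finset.sum_congr rfl fun l _ => ?_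
    rw [hM l]
    simp only [map_sum, map_mul, Finset.sum_mul, mul_assoc]

lemma map_constantCoeff_genericTranslation (M : Matrix ι ι k) (f : MvPolynomial ι k) :
    MvPolynomial.map constantCoeff (genericTranslation M f) = polySub M f := by
  induction f using MvPolynomial.induction_on with
  | C r => rw [polySub_C, genericTranslation_C, map_C, constantCoeff_C]
  | add p q hp hq => rw [map_add, map_add, hp, hq, map_add]
  | mul_X p i hp =>
    rw [map_mul, map_mul, hp, map_mul]
    simp [genericTranslation_X, polySub_X]

lemma eval₂_genericTranslation_neg (M : Matrix ι ι k) (f : MvPolynomial ι k) :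
    eval₂Hom (genericTranslation M) X (genericTranslation (-M) f) = C f := by
  induction f using MvPolynomial.induction_on with
  | C r => rw [genericTranslation_C, eval₂Hom_C, genericTranslation_C]
  | add p q hp hq => rw [map_add, map_add, hp, hq, map_add]
  | mul_X p i hp =>
    rw [map_mul, map_mul, hp, map_mul]
    refine congrArg (_ * ·) ?_
    simp [genericTranslation_X, genericTranslation_C, add_assoc, ← Finset.sum_add_distrib,
      ← add_mul]

/-- Conjugating a map linear over the invariants by the generic translation along a subspace fixed
by `S` moves the nonvanishing of its value at `1` from that subspace to the origin. -/
lemma exists_constantCoeff_ne_zero (S : Set (Matrix ι ι k)) (M : Matrix ι ι k)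
    (hM : ∀ g ∈ S, g⁻¹ * M = M) (ψ : MvPolynomial ι k →+ MvPolynomial ι k)
    (hψ : ∀ c ∈ invariantRing S, ∀ a, ψ (c * a) = c * ψ a)
    (hmem : ∀ a, ψ a ∈ invariantRing S) (h1 : polySub M (ψ 1) ≠ 0) :
    ∃ ψ' : MvPolynomial ι k →+ MvPolynomial ι k,
      (∀ c ∈ invariantRing S, ∀ a, ψ' (c * a) = c * ψ' a) ∧
      (∀ a, ψ' a ∈ invariantRing S) ∧ constantCoeff (ψ' 1) ≠ 0 := by
  set σ := genericTranslation M with hσ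
  set τ := genericTranslation (-M) with hτ
  set E := eval₂Hom σ X with hE
  have hcoeff {N : Matrix ι ι k} (hN : ∀ g ∈ S, g⁻¹ * N = N) (c : MvPolynomial ι k)
      (hc : c ∈ invariantRing S) (m : ι →₀ ℕ) : coeff m (genericTranslation N c) ∈
        invariantRing S := by
    rw [mem_invariantRing] at hc ⊢
    intro g hg
    have h := congrArg (coeff m) (map_polySub_genericTranslation (hN g hg) c)
    rw [coeff_map] at h
    rwa [← polyAct, hc g hg] at h
  let Θ : MvPolynomial ι (MvPolynomial ι k) →+ MvPolynomial ι (MvPolynomial ι k) :=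
    (Finsupp.liftAddHom fun m => (AddMonoidHom.mulRight (monomial m 1)).comp
      (σ.toAddMonoidHom.comp ψ)).comp
      (basisMonomials ι (MvPolynomial ι k)).repr.toLinearMap.toAddMonoidHom
  have hΘ (m : ι →₀ ℕ) (a : MvPolynomial ι k) :
      Θ (monomial m a) = σ (ψ a) * monomial m 1 := by
    have hm : (basisMonomials ι (MvPolynomial ι k)).repr (monomial m a) = Finsupp.single m a := by
      have : monomial m a = a • basisMonomials ι (MvPolynomial ι k) m := by
        rw [coe_basisMonomials, smul_monomial, smul_eq_mul, mul_one]
      rw [this, map_smul, Module.Basis.repr_self, Finsupp.smul_single, smul_eq_mul, mul_one]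
    change Finsupp.liftAddHom _ ((basisMonomials ι (MvPolynomial ι k)).repr (monomial m a)) = _
    rw [hm, Finsupp.liftAddHom_apply_single]
    rfl
  have hΘmul (q s : MvPolynomial ι (MvPolynomial ι k)) (hq : ∀ m, coeff m q ∈ invariantRing S) :
      Θ (q * s) = E q * Θ s := by
    conv_lhs => rw [q.as_sum]
    conv_rhs => rw [q.as_sum]
    rw [Finset.sum_mul, map_sum, map_sum, Finset.sum_mul]
    refine Finset.sum_congr rfl fun m _ => ?_
    induction s using MvPolynomial.induction_on' with
    | monomial m' a =>
      have hmon : E (monomial m (coeff m q)) = σ (coeff m q) * monomial m 1 := by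
        rw [← mul_one (coeff m q), ← C_mul_monomial, map_mul, hE, eval₂Hom_C, mul_one]
        simp [monomial_eq]
      rw [monomial_mul, hΘ, hΘ, hψ _ (hq m), map_mul, hmon, ← one_mul (1 : MvPolynomial ι k),
        ← monomial_mul, one_mul]
      ring
    | add s s' hs hs' => rw [mul_add, map_add, hs, hs', map_add, mul_add]
  have hΘmem (s : MvPolynomial ι (MvPolynomial ι k)) (m : ι →₀ ℕ) :
      coeff m (Θ s) ∈ invariantRing S := by
    induction s using MvPolynomial.induction_on' with
    | monomial m' a =>
      rw [hΘ, coeff_mul_monomial']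
      split_ifs
      · rw [mul_one]
        exact hcoeff hM _ (hmem a) _
      · exact zero_mem _
    | add s s' hs hs' =>
      rw [map_add, coeff_add]
      exact add_mem hs hs'
  obtain ⟨β, hβ⟩ := ne_zero_iff.1 h1
  refine ⟨(coeffAddMonoidHom β).comp (Θ.comp τ.toAddMonoidHom), fun c hc a => ?_,
    fun a => hΘmem _ β, ?_⟩
  · change coeff β (Θ (τ (c * a))) = c * coeff β (Θ (τ a))
    rw [map_mul, hΘmul _ _ (hcoeff (fun g hg => by rw [mul_neg, hM g hg]) c hc), hE, hσ, hτ,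
      eval₂_genericTranslation_neg, coeff_C_mul]
  · change constantCoeff (coeff β (Θ (τ 1))) ≠ 0
    have hone : Θ (τ 1) = σ (ψ 1) := by
      rw [map_one, ← C_1, C_apply, hΘ, ← C_apply, C_1, mul_one]
    rwa [hone, ← coeff_map, hσ, map_constantCoeff_genericTranslation]

end Translation

/-- The action of a group of matrices on polynomial functions. -/
noncomputable abbrev polyMulSemiringAction {n : ℕ} (G : Subgroup (GL (Fin n) k)) :
    MulSemiringAction G (MvPolynomial (Fin n) k) where
  smul g f := polyAct (g : GL (Fin n) k).val f
  one_smul f := by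
    change polySub _ f = f
    simp [polySub_one]
  mul_smul g h f := by
    change polySub _ f = polySub _ (polySub _ f)
    simp [polySub_polySub, Matrix.mul_inv_rev]
  smul_zero _ := map_zero _
  smul_add _ := map_add _
  smul_one _ := map_one _
  smul_mul _ := map_mul _

lemma mem_invariantRing_matSet {n : ℕ} {G : Subgroup (GL (Fin n) k)}
    {f : MvPolynomial (Fin n) k} :
    f ∈ invariantRing (matSet G) ↔ ∀ g ∈ G, polyAct g.val f = f := by
  simp [mem_invariantRing, matSet]

lemma exists_matrix_range_eq {n : ℕ} (U : Submodule k (Fin n → k)) :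
    ∃ M : Matrix (Fin n) (Fin n) k, LinearMap.range M.mulVecLin = U := by
  obtain ⟨p, hp⟩ := U.subtype.exists_leftInverse_of_injective U.ker_subtype
  refine ⟨LinearMap.toMatrix' (U.subtype ∘ₗ p), ?_⟩
  rw [← Matrix.toLin'_apply', Matrix.toLin'_toMatrix', LinearMap.range_comp,
    (LinearMap.range_eq_top (f := p)).2 fun u => ⟨u, DFunLike.congr_fun hp u⟩, Submodule.map_top,
    Submodule.range_subtype]

lemma mul_eq_self_iff {n : ℕ} {M : Matrix (Fin n) (Fin n) k} (g : Matrix (Fin n) (Fin n) k) :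
    g * M = M ↔ ∀ u ∈ LinearMap.range M.mulVecLin, g *ᵥ u = u := by
  simp [Matrix.ext_iff_mulVec, Matrix.mulVec_mulVec]

/-- If the action of a finite group `G ≤ GL(V)` on `V` has the direct summand
property, then so does the action of the point stabilizer of any linear subspace
`U ⊆ V`. -/
theorem directSummand_pointStabilizer {k : Type} [Field k] {n : ℕ}
    (G : Subgroup (GL (Fin n) k)) [Finite G] (U : Submodule k (Fin n → k))
    (hG : DirectSummand (matSet G)) :
    DirectSummand (matSet (pointStabilizer G U)) := by
  obtain ⟨M, hM⟩ := exists_matrix_range_eq U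
  have hstab (g : GL (Fin n) k) (hg : g ∈ G) : g ∈ pointStabilizer G U ↔ g.val⁻¹ * M = M := by
    rw [← inv_mem_iff, mul_eq_self_iff, hM, ← coe_units_inv]
    exact and_iff_right (G.inv_mem hg)
  obtain ⟨π, hπ, -⟩ := hG
  obtain ⟨a₀, ha₀⟩ := hπ 1
  let φ : MvPolynomial (Fin n) k →+ MvPolynomial (Fin n) k :=
    (invariantRing (matSet G)).val.toLinearMap.toAddMonoidHom.comp
      (π.toAddMonoidHom.comp (AddMonoidHom.mulRight a₀))
  have hφ (a : MvPolynomial (Fin n) k) : φ a = π (a * a₀) := rfl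
  let _ := polyMulSemiringAction G
  have hsmul (g : G) (f : MvPolynomial (Fin n) k) : g • f = polySub (g : GL (Fin n) k).val⁻¹ f :=
    rfl
  let H := (pointStabilizer G U).subgroupOf G
  let P := RingHom.ker (polySub M)
  have : P.IsPrime := RingHom.ker_isPrime _
  have hmoved (g g' : Matrix (Fin n) (Fin n) k) (h : g ≠ g') :
      ∃ y, polySub g y ≠ polySub g' y := by
    by_contra! hy
    exact h (polySub_injective (DFunLike.ext _ _ hy))
  obtain ⟨ψ, hψ, hψmem, hψ1⟩ := exists_linear_map_one_notMem (Γ := G)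
    (A := MvPolynomial (Fin n) k)
    (fun g hg => by
      obtain ⟨y, hy⟩ := hmoved (g : GL (Fin n) k).val⁻¹ 1 fun h => hg <| by
        rw [← coe_units_inv] at h
        exact Subtype.ext (inv_eq_one.1 (Units.ext h))
      exact ⟨y, by rwa [polySub_one] at hy⟩)
    H P
    (fun h hh a => by
      rw [RingHom.mem_ker, map_sub, hsmul, polySub_polySub, (hstab _ h.2).1 hh, sub_self])
    (fun g hg => by
      obtain ⟨y, hy⟩ := hmoved ((g : GL (Fin n) k).val⁻¹ * M) M fun h => hg ((hstab _ g.2).2 h)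
      refine ⟨y, ?_⟩
      rwa [RingHom.mem_ker, map_sub, hsmul, polySub_polySub, sub_eq_zero])
    φ
    (fun b a hb => by
      have hb' : b ∈ invariantRing (matSet G) :=
        mem_invariantRing_matSet.2 fun g hg => hb ⟨g, hg⟩
      rw [hφ, hφ, mul_assoc]
      exact congrArg Subtype.val (π.map_smul ⟨b, hb'⟩ (a * a₀)))
    (fun a g => mem_invariantRing_matSet.1 (π (a * a₀)).2 g g.2)
    (by rw [hφ, one_mul, ha₀]; rfl)
  have hinv (c : MvPolynomial (Fin n) k) :
      c ∈ invariantRing (matSet (pointStabilizer G U)) ↔ ∀ h ∈ H, h • c = c := by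
    rw [mem_invariantRing_matSet]
    exact ⟨fun hc h hh => hc h hh, fun hc g hg => hc ⟨g, hg.1⟩ hg⟩
  obtain ⟨ψ', hψ', hmem', h1'⟩ := exists_constantCoeff_ne_zero (matSet (pointStabilizer G U)) M
    (by rintro _ ⟨g, hg, rfl⟩; exact (hstab g hg.1).1 hg) ψ
    (fun c hc a => hψ c a ((hinv c).1 hc)) (fun a => (hinv _).2 (hψmem a)) hψ1
  exact directSummand_of_constantCoeff_ne_zero _ ψ' hψ' hmem' h1'
end

section
/- Let k = F_{q²} be the field with q² elements (q a power of a prime p), n ≥ 2, and V = k^{2n}. Let G_n ≤ GL_{2n}(k) be the group of block matrices [[I,O],[B,I]] where B is an n×n matrix over k with B̄ = -Bᵀ (anti-hermitian), where B̄ denotes entrywise q-th power. Then the action of G_n on V is not coregular and does not have the direct summand property. -/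
open MvPolynomial Matrix

set_option synthInstance.maxHeartbeats 1000000
set_option maxHeartbeats 1000000

variable {k : Type} [Field k] {ι : Type} [Fintype ι] [DecidableEq ι]

/-- The group of block matrices `[[I,O],[B,I]]` with `B` anti-hermitian
(`B̄ = -Bᵀ`, entrywise `q`-th power), viewed as a set of `2n × 2n` matrices over
`k = F_{q²}`. -/
def antiHermitianTransvections (q n : ℕ) (k : Type) [Field k] :
    Set (Matrix (Fin n ⊕ Fin n) (Fin n ⊕ Fin n) k) :=
  {M | ∃ B : Matrix (Fin n) (Fin n) k,
    (∀ i j, (B i j) ^ q = - B j i) ∧ M = Matrix.fromBlocks 1 0 B 1}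

/-! ### The action of the transvections on polynomials -/

/-- A matrix `B` with `B̄ = -Bᵀ`, the bar being the entrywise `q`-th power. -/
def IsAntiHermitian {n : ℕ} (q : ℕ) (B : Matrix (Fin n) (Fin n) k) : Prop :=
  ∀ i j, (B i j) ^ q = - B j i

/-- The substitution `x ↦ x`, `y ↦ y + B x`. -/
noncomputable def shear {n : ℕ} (B : Matrix (Fin n) (Fin n) k) :
    MvPolynomial (Fin n ⊕ Fin n) k →ₐ[k] MvPolynomial (Fin n ⊕ Fin n) k :=
  aeval (Sum.elim (fun i => X (Sum.inl i))
    (fun i => X (Sum.inr i) + ∑ j, C (B i j) * X (Sum.inl j)))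

lemma polySub_fromBlocks {n : ℕ} (B : Matrix (Fin n) (Fin n) k) :
    polySub (Matrix.fromBlocks 1 0 B 1) = shear B := by
  refine MvPolynomial.algHom_ext fun i => ?_
  rcases i with i | i
  · simp [polySub, shear, Matrix.one_apply]
  · simp [polySub, shear, Matrix.one_apply, add_comm]

lemma neg_pow_prime_pow {R : Type*} [CommRing R] (p r : ℕ) [Fact p.Prime] [CharP R p] (a : R) :
    (-a) ^ p ^ r = -(a ^ p ^ r) := by
  simpa [iterateFrobenius_def] using map_neg (iterateFrobenius R p r) a

lemma IsAntiHermitian.neg {n p r : ℕ} [Fact p.Prime] [CharP k p]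
    {B : Matrix (Fin n) (Fin n) k} (hB : IsAntiHermitian (p ^ r) B) :
    IsAntiHermitian (p ^ r) (-B) := fun i j => by
  rw [Matrix.neg_apply, neg_pow_prime_pow, hB, Matrix.neg_apply]

lemma mem_invariantRing_iff {n p r : ℕ} [Fact p.Prime] [CharP k p]
    {f : MvPolynomial (Fin n ⊕ Fin n) k} :
    f ∈ invariantRing (antiHermitianTransvections (p ^ r) n k) ↔
      ∀ B : Matrix (Fin n) (Fin n) k, IsAntiHermitian (p ^ r) B → shear B f = f := by
  have inv_eq : ∀ B : Matrix (Fin n) (Fin n) k,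
      (Matrix.fromBlocks 1 0 B 1)⁻¹ = Matrix.fromBlocks 1 0 (-B) 1 := fun B =>
    Matrix.inv_eq_right_inv (by simp [Matrix.fromBlocks_multiply])
  simp only [invariantRing, Algebra.mem_iInf, AlgHom.mem_equalizer, AlgHom.id_apply, polyAct]
  constructor
  · intro h B hB
    have := h _ ⟨-B, hB.neg, rfl⟩
    rwa [inv_eq, neg_neg, polySub_fromBlocks] at this
  · rintro h _ ⟨B, hB, rfl⟩
    rw [inv_eq, polySub_fromBlocks]
    exact h _ (IsAntiHermitian.neg hB)

/-- The anti-hermitian matrix with entries `b` at `(i, j)` and `-b ^ q` at `(j, i)`. -/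
def antiHermitianPair {n : ℕ} (q : ℕ) (i j : Fin n) (b : k) : Matrix (Fin n) (Fin n) k :=
  Matrix.of fun s t => if s = i ∧ t = j then b else if s = j ∧ t = i then -b ^ q else 0

lemma isAntiHermitian_antiHermitianPair {n p r : ℕ} [Fact p.Prime] [CharP k p]
    (hpow : ∀ b : k, (b ^ p ^ r) ^ p ^ r = b) {i j : Fin n} (hij : i ≠ j) (b : k) :
    IsAntiHermitian (p ^ r) (antiHermitianPair (p ^ r) i j b) := by
  have h0 : (0 : k) ^ p ^ r = 0 := zero_pow (pow_ne_zero _ (Fact.out : p.Prime).ne_zero)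
  intro s t
  simp only [antiHermitianPair, Matrix.of_apply]
  by_cases h1 : s = i ∧ t = j
  · have : ¬ (t = i ∧ s = j) := fun h => hij (h1.1 ▸ h.2)
    rw [if_pos h1, if_neg this, if_pos h1.symm, neg_neg]
  · by_cases h2 : s = j ∧ t = i
    · rw [if_neg h1, if_pos h2, if_pos h2.symm, neg_pow_prime_pow, hpow]
    · rw [if_neg h1, if_neg h2, if_neg (fun h => h2 h.symm), if_neg (fun h => h1 h.symm), h0,
        neg_zero]

/-! ### Small powers of a single `y` do not occur in invariants -/

/-- The substitution `x_j ↦ T`, `y_i ↦ b T` and all other variables to `0`. -/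
noncomputable def lineSub {n : ℕ} {A : Type*} [CommRing A] [Algebra k A] (i j : Fin n) (b : A) :
    MvPolynomial (Fin n ⊕ Fin n) k →ₐ[k] Polynomial A :=
  aeval (Sum.elim (fun s => if s = j then Polynomial.X else 0)
    (fun s => if s = i then Polynomial.C b * Polynomial.X else 0))

lemma lineSub_comp_shear {n : ℕ} (q : ℕ) {i j : Fin n} (hij : i ≠ j) (b : k) :
    (lineSub i j (0 : k)).comp (shear (antiHermitianPair q i j b)) = lineSub i j b := by
  refine MvPolynomial.algHom_ext fun s => ?_
  rcases s with s | s
  · simp [lineSub, shear]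
  · by_cases hs : s = i
    · subst hs
      simp [lineSub, shear, antiHermitianPair, ← MvPolynomial.algebraMap_eq,
        Polynomial.algebraMap_eq]
    · simp [lineSub, shear, antiHermitianPair, hs, hij.symm, ← MvPolynomial.algebraMap_eq]

lemma map_lineSub {n : ℕ} (i j : Fin n) (b : k) (f : MvPolynomial (Fin n ⊕ Fin n) k) :
    (lineSub i j (Polynomial.X : Polynomial k) f).map (Polynomial.evalRingHom b) =
      lineSub i j b f := by
  have : (Polynomial.mapAlgHom (Polynomial.aeval b : Polynomial k →ₐ[k] k)).comp
      (lineSub i j (Polynomial.X : Polynomial k)) = lineSub i j b := by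
    refine MvPolynomial.algHom_ext fun s => ?_
    rcases s with s | s
    · by_cases hs : s = j <;> simp [lineSub, hs]
    · by_cases hs : s = i <;> simp [lineSub, hs]
  rw [← this]
  rfl

lemma coeff_zero_lineSub_X {n : ℕ} {A : Type*} [CommRing A] [Algebra k A] (i j : Fin n) (b : A)
    (s : Fin n ⊕ Fin n) : (lineSub i j b (X s : MvPolynomial _ k)).coeff 0 = 0 := by
  rcases s with s | s
  · by_cases hs : s = j <;> simp [lineSub, hs]
  · by_cases hs : s = i <;> simp [lineSub, hs]

lemma natDegree_coeff_lineSub_le {n : ℕ} (i j : Fin n) (f : MvPolynomial (Fin n ⊕ Fin n) k) :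
    ∀ d, ((lineSub i j (Polynomial.X : Polynomial k) f).coeff d).natDegree ≤ d := by
  induction f using MvPolynomial.induction_on with
  | C a =>
    intro d
    rw [← MvPolynomial.algebraMap_eq, AlgHom.commutes, Polynomial.algebraMap_apply,
      Polynomial.coeff_C]
    split_ifs <;> simp [Polynomial.algebraMap_eq]
  | add f g hf hg =>
    intro d
    rw [map_add, Polynomial.coeff_add]
    exact (Polynomial.natDegree_add_le _ _).trans (max_le (hf d) (hg d))
  | mul_X f s hf =>
    intro d
    rcases d with _ | d
    · simp [Polynomial.mul_coeff_zero, coeff_zero_lineSub_X]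
    · rcases s with s | s
      · by_cases hs : s = j
        · have := hf d
          simp only [map_mul]
          rw [show lineSub i j (Polynomial.X : Polynomial k) (X (Sum.inl s)) = Polynomial.X by
            simp [lineSub, hs], Polynomial.coeff_mul_X]
          omega
        · simp [lineSub, hs]
      · by_cases hs : s = i
        · have := hf d
          simp only [map_mul]
          rw [show lineSub i j (Polynomial.X : Polynomial k) (X (Sum.inr s)) =
              Polynomial.C Polynomial.X * Polynomial.X by simp [lineSub, hs],
            ← mul_assoc, Polynomial.coeff_mul_X, Polynomial.coeff_mul_C]
          exact (Polynomial.natDegree_mul_le).trans (by simpa using this)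
        · simp [lineSub, hs]

lemma coeff_coeff_lineSub {n : ℕ} (i j : Fin n) (f : MvPolynomial (Fin n ⊕ Fin n) k) :
    ∀ d, ((lineSub i j (Polynomial.X : Polynomial k) f).coeff d).coeff d =
      f.coeff (Finsupp.single (Sum.inr i) d) := by
  induction f using MvPolynomial.induction_on with
  | C a =>
    intro d
    rw [← MvPolynomial.algebraMap_eq, AlgHom.commutes, Polynomial.algebraMap_apply,
      Polynomial.coeff_C, MvPolynomial.algebraMap_eq, MvPolynomial.coeff_C,
      Polynomial.algebraMap_eq]
    rcases d with _ | d
    · simp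
    · rw [if_neg (by simp), if_neg (fun h => by simpa using DFunLike.congr_fun h (Sum.inr i))]
      simp
  | add f g hf hg =>
    intro d
    simp [hf, hg]
  | mul_X f s hf =>
    intro d
    rw [MvPolynomial.coeff_mul_X', map_mul]
    rcases d with _ | d
    · simp [Polynomial.mul_coeff_zero, coeff_zero_lineSub_X]
    · rcases s with s | s
      · rw [if_neg (by simp)]
        by_cases hs : s = j
        · rw [show lineSub i j (Polynomial.X : Polynomial k) (X (Sum.inl s)) = Polynomial.X by
            simp [lineSub, hs], Polynomial.coeff_mul_X]
          exact Polynomial.coeff_eq_zero_of_natDegree_lt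
            (Nat.lt_succ_of_le (natDegree_coeff_lineSub_le i j f d))
        · simp [lineSub, hs]
      · by_cases hs : s = i
        · subst hs
          rw [if_pos (by simp), show lineSub s j (Polynomial.X : Polynomial k) (X (Sum.inr s)) =
              Polynomial.C Polynomial.X * Polynomial.X by simp [lineSub],
            ← mul_assoc, Polynomial.coeff_mul_X, Polynomial.coeff_mul_C, Polynomial.coeff_mul_X,
            hf, ← Finsupp.single_tsub, Nat.add_sub_cancel]
        · rw [if_neg (by simp [Ne.symm hs])]
          simp [lineSub, hs]

lemma coeff_single_inr_eq_zero {n p r : ℕ} [Fact p.Prime] [CharP k p] [Fintype k]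
    (hpow : ∀ b : k, (b ^ p ^ r) ^ p ^ r = b) {i j : Fin n} (hij : i ≠ j)
    {f : MvPolynomial (Fin n ⊕ Fin n) k}
    (hf : f ∈ invariantRing (antiHermitianTransvections (p ^ r) n k)) {d : ℕ} (hd : 0 < d)
    (hd' : d < Fintype.card k) :
    f.coeff (Finsupp.single (Sum.inr i) d) = 0 := by
  rw [← coeff_coeff_lineSub i j f d]
  set R := (lineSub i j (Polynomial.X : Polynomial k) f).coeff d with hR
  have heval : ∀ b, R.eval b = (lineSub i j b f).coeff d := fun b => by
    rw [← map_lineSub, Polynomial.coeff_map, Polynomial.coe_evalRingHom]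
  have hconst : ∀ b, R.eval b = R.eval 0 := fun b => by
    rw [heval, heval, ← lineSub_comp_shear (p ^ r) hij b, AlgHom.comp_apply,
      mem_invariantRing_iff.1 hf _ (isAntiHermitian_antiHermitianPair hpow hij b)]
  have hle : (R - Polynomial.C (R.eval 0)).natDegree ≤ d := by
    rw [Polynomial.natDegree_sub_C]
    exact natDegree_coeff_lineSub_le i j f d
  have hzero : R - Polynomial.C (R.eval 0) = 0 :=
    Polynomial.eq_zero_of_natDegree_lt_card_of_eval_eq_zero _ Function.injective_id
      (fun b => by simp [hconst b]) (hle.trans_lt hd')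
  rw [sub_eq_zero.1 hzero, Polynomial.coeff_C, if_neg hd.ne']

/-! ### The invariant hermitian form -/

/-- The cofactor of `x_i` in the hermitian form. -/
noncomputable def formCofactor {n : ℕ} (k : Type) [Field k] (q : ℕ) (i : Fin n) :
    MvPolynomial (Fin n ⊕ Fin n) k :=
  X (Sum.inl i) ^ (q - 1) * X (Sum.inr i) + X (Sum.inr i) ^ q

/-- The form `∑ i, (x_i ^ q * y_i + x_i * y_i ^ q)`. -/
noncomputable def hermitianForm (n : ℕ) (k : Type) [Field k] (q : ℕ) :
    MvPolynomial (Fin n ⊕ Fin n) k :=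
  ∑ i, X (Sum.inl i) * formCofactor k q i

lemma formCofactor_isHomogeneous {n q : ℕ} (hq : 0 < q) (i : Fin n) :
    (formCofactor k q i).IsHomogeneous q := by
  refine IsHomogeneous.add ?_ ?_
  · have := ((isHomogeneous_X k (Sum.inl i : Fin n ⊕ Fin n)).pow (q - 1)).mul
      (isHomogeneous_X k (Sum.inr i))
    rwa [one_mul, Nat.sub_add_cancel hq] at this
  · simpa using (isHomogeneous_X k (Sum.inr i : Fin n ⊕ Fin n)).pow q

lemma X_inl_mem_invariantRing {n p r : ℕ} [Fact p.Prime] [CharP k p] (i : Fin n) :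
    X (Sum.inl i) ∈ invariantRing (antiHermitianTransvections (p ^ r) n k) :=
  mem_invariantRing_iff.2 fun B _ => by simp [shear]

lemma hermitianForm_mem_invariantRing {n p r : ℕ} [Fact p.Prime] [CharP k p] :
    hermitianForm n k (p ^ r) ∈ invariantRing (antiHermitianTransvections (p ^ r) n k) := by
  have hq : 0 < p ^ r := pow_pos (Fact.out : p.Prime).pos r
  have hform : hermitianForm n k (p ^ r) =
      ∑ i, (X (Sum.inl i) ^ p ^ r * X (Sum.inr i) + X (Sum.inl i) * X (Sum.inr i) ^ p ^ r) := by
    refine Finset.sum_congr rfl fun i _ => ?_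
    rw [formCofactor, mul_add, ← mul_assoc, mul_pow_sub_one hq.ne']
  refine mem_invariantRing_iff.2 fun B hB => ?_
  have hx : ∀ i, shear B (X (Sum.inl i)) = X (Sum.inl i) := fun i => by simp [shear]
  have hy : ∀ i, shear B (X (Sum.inr i)) = X (Sum.inr i) + ∑ j, C (B i j) * X (Sum.inl j) :=
    fun i => by simp [shear]
  have hcancel : ∑ i, ((X (Sum.inl i) : MvPolynomial (Fin n ⊕ Fin n) k) ^ p ^ r *
      ∑ j, C (B i j) * X (Sum.inl j) +
        X (Sum.inl i) * (∑ j, C (B i j) * X (Sum.inl j)) ^ p ^ r) = 0 := by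
    simp only [sum_pow_char_pow, mul_pow, ← C_pow, hB _ _, Finset.mul_sum, Finset.sum_add_distrib]
    rw [Finset.sum_comm, ← Finset.sum_add_distrib]
    refine Finset.sum_eq_zero fun i _ => ?_
    rw [← Finset.sum_add_distrib]
    refine Finset.sum_eq_zero fun j _ => ?_
    rw [C_neg]
    ring
  rw [hform, map_sum, ← sub_eq_zero, ← Finset.sum_sub_distrib, ← hcancel]
  refine Finset.sum_congr rfl fun i _ => ?_
  simp only [map_add, map_mul, map_pow, hx, hy, add_pow_char_pow]
  ring

lemma coeff_X_inl_mul {n q : ℕ} (i₀ i : Fin n) (h : MvPolynomial (Fin n ⊕ Fin n) k) :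
    (X (Sum.inl i) * h).coeff (Finsupp.single (Sum.inl i₀) 1 + Finsupp.single (Sum.inr i₀) q) =
      if i = i₀ then h.coeff (Finsupp.single (Sum.inr i₀) q) else 0 := by
  rw [coeff_X_mul']
  by_cases hi : i = i₀
  · subst hi
    simp
  · rw [if_neg, if_neg hi]
    simp [Ne.symm hi]

lemma coeff_formCofactor {n q : ℕ} (hq : 1 < q) (i : Fin n) :
    (formCofactor k q i).coeff (Finsupp.single (Sum.inr i) q) = 1 := by
  rw [formCofactor, coeff_add, coeff_X_pow, if_pos rfl, coeff_mul_X', X_pow_eq_monomial]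
  split_ifs
  · rw [coeff_monomial, if_neg, zero_add]
    intro h
    have := DFunLike.congr_fun h (Sum.inl i)
    simp at this
    omega
  · rw [zero_add]

lemma coeff_hermitianForm {n q : ℕ} (hq : 1 < q) (i : Fin n) :
    (hermitianForm n k q).coeff (Finsupp.single (Sum.inl i) 1 + Finsupp.single (Sum.inr i) q) =
      1 := by
  simp [hermitianForm, coeff_sum, coeff_X_inl_mul, coeff_formCofactor hq]

/-! ### The direct summand property fails -/

lemma not_directSummand {n p r : ℕ} [Fact p.Prime] [CharP k p] [Fintype k] (hr : 0 < r)
    (hk : Fintype.card k = (p ^ r) ^ 2) (hpow : ∀ b : k, (b ^ p ^ r) ^ p ^ r = b)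
    {i j : Fin n} (hij : i ≠ j) :
    ¬ DirectSummand (antiHermitianTransvections (p ^ r) n k) := by
  rintro ⟨π, hsurj, hhom⟩
  have hq : 1 < p ^ r := Nat.one_lt_pow hr.ne' (Fact.out : p.Prime).one_lt
  have hsmul : ∀ {a : MvPolynomial (Fin n ⊕ Fin n) k}
      (ha : a ∈ invariantRing (antiHermitianTransvections (p ^ r) n k))
      (f : MvPolynomial (Fin n ⊕ Fin n) k),
      (π (a * f) : MvPolynomial (Fin n ⊕ Fin n) k) = a * π f := fun {a} ha f =>
    congrArg Subtype.val (π.map_smul ⟨a, ha⟩ f)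
  obtain ⟨c, hc⟩ : ∃ c : k, (π 1 : MvPolynomial (Fin n ⊕ Fin n) k) = C c :=
    ⟨_, totalDegree_eq_zero_iff_eq_C.1
      ((totalDegree_zero_iff_isHomogeneous _).2 (hhom 0 1 (isHomogeneous_one _ _)))⟩
  have hform : (hermitianForm n k (p ^ r)) * C c =
      ∑ s, X (Sum.inl s) * (π (formCofactor k (p ^ r) s) : MvPolynomial (Fin n ⊕ Fin n) k) := by
    rw [← hc, ← hsmul hermitianForm_mem_invariantRing, mul_one, hermitianForm, map_sum,
      AddSubmonoidClass.coe_finsetSum]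
    exact Finset.sum_congr rfl fun s _ => hsmul (X_inl_mem_invariantRing s) _
  have hc0 : c = 0 := by
    have := congrArg (coeff (Finsupp.single (Sum.inl i) 1 + Finsupp.single (Sum.inr i) (p ^ r)))
      hform
    rw [mul_comm, coeff_C_mul, coeff_hermitianForm hq, mul_one] at this
    rw [this]
    simp only [coeff_sum, coeff_X_inl_mul, Finset.sum_ite_eq', Finset.mem_univ, if_true]
    exact coeff_single_inr_eq_zero hpow hij (π _).2 (by omega) (by rw [hk]; nlinarith)
  have hconst : ∀ g, constantCoeff (π g : MvPolynomial (Fin n ⊕ Fin n) k) = 0 := by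
    intro g
    induction g using MvPolynomial.induction_on' with
    | monomial m a =>
      by_cases hm : m.degree = 0
      · rw [Finsupp.degree_eq_zero_iff] at hm
        subst hm
        have := hsmul (Subalgebra.algebraMap_mem _ a) 1
        rw [mul_one, hc, hc0, C_0, mul_zero] at this
        change constantCoeff (π (C a) : MvPolynomial (Fin n ⊕ Fin n) k) = 0
        rw [← MvPolynomial.algebraMap_eq, this, map_zero]
      · by_contra h
        exact hm (by simpa using (hhom _ _ (isHomogeneous_monomial a rfl) h).symm)
    | add f g hf hg => rw [map_add, Subalgebra.coe_add, map_add, hf, hg, add_zero]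
  obtain ⟨g, hg⟩ := hsurj 1
  have := hconst g
  rw [hg] at this
  simp at this

/-! ### Coregularity fails -/

/-- The restriction of polynomials to the subspace `x = 0`. -/
noncomputable def restrictY (n : ℕ) (k : Type) [Field k] :
    MvPolynomial (Fin n ⊕ Fin n) k →ₐ[k] MvPolynomial (Fin n) k :=
  aeval (Sum.elim 0 X)

/-- The product of all `y_i + v ⬝ x`. -/
noncomputable def orbitProduct {n : ℕ} (k : Type) [Field k] [Fintype k] (i : Fin n) :
    MvPolynomial (Fin n ⊕ Fin n) k :=
  ∏ v : Fin n → k, (X (Sum.inr i) + ∑ j, C (v j) * X (Sum.inl j))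

lemma orbitProduct_mem_invariantRing {n p r : ℕ} [Fact p.Prime] [CharP k p] [Fintype k]
    (i : Fin n) :
    orbitProduct k i ∈ invariantRing (antiHermitianTransvections (p ^ r) n k) := by
  refine mem_invariantRing_iff.2 fun B _ => ?_
  rw [orbitProduct, map_prod]
  refine Fintype.prod_equiv (Equiv.addLeft (B i)) _ _ fun v => ?_
  simp [shear, algHom_C, add_mul, Finset.sum_add_distrib, add_assoc]

lemma restrictY_orbitProduct {n : ℕ} [Fintype k] (i : Fin n) :
    restrictY n k (orbitProduct k i) = X i ^ Fintype.card (Fin n → k) := by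
  simp [restrictY, orbitProduct, map_prod]

/-- The `x`-part of the differential at the origin. -/
noncomputable def linearPartX (n : ℕ) (k : Type) [Field k] :
    MvPolynomial (Fin n ⊕ Fin n) k →ₗ[k] (Fin n → k) :=
  LinearMap.pi fun i => (aeval (0 : Fin n ⊕ Fin n → k)).toLinearMap ∘ₗ
    (pderiv (Sum.inl i)).toLinearMap

lemma linearPartX_mem_span {n : ℕ} {κ : Type*} {F : κ → MvPolynomial (Fin n ⊕ Fin n) k}
    {a : MvPolynomial (Fin n ⊕ Fin n) k} (ha : a ∈ Algebra.adjoin k (Set.range F)) :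
    linearPartX n k a ∈ Submodule.span k (Set.range fun i => linearPartX n k (F i)) := by
  induction ha using Algebra.adjoin_induction with
  | mem x hx =>
    obtain ⟨i, rfl⟩ := hx
    exact Submodule.subset_span ⟨i, rfl⟩
  | algebraMap c =>
    convert Submodule.zero_mem _
    ext i
    simp [linearPartX, MvPolynomial.algebraMap_eq]
  | add x y _ _ hx hy => rw [map_add]; exact Submodule.add_mem _ hx hy
  | mul x y _ _ hx hy =>
    have : linearPartX n k (x * y) = aeval (0 : Fin n ⊕ Fin n → k) x • linearPartX n k y +
        aeval (0 : Fin n ⊕ Fin n → k) y • linearPartX n k x := by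
      ext i
      simp [linearPartX]
    rw [this]
    exact Submodule.add_mem _ (Submodule.smul_mem _ _ hy) (Submodule.smul_mem _ _ hx)

lemma linearPartX_X_inl {n : ℕ} (i : Fin n) :
    linearPartX n k (X (Sum.inl i)) = Pi.single i 1 := by
  ext j
  simp [linearPartX, pderiv_X, Pi.single_apply, eq_comm]

lemma isHomogeneous_one_of_linearPartX_ne_zero {n d : ℕ} {f : MvPolynomial (Fin n ⊕ Fin n) k}
    (hf : f.IsHomogeneous d) (h : linearPartX n k f ≠ 0) : f.IsHomogeneous 1 := by
  obtain ⟨i, hi⟩ := Function.ne_iff.1 h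
  have hi' : constantCoeff (pderiv (Sum.inl i) f) ≠ 0 := by
    simpa [linearPartX, constantCoeff_eq, aeval_zero] using hi
  have hd := hf.pderiv (i := Sum.inl i) hi'
  rcases d with _ | d
  · rw [totalDegree_eq_zero_iff_eq_C.1 ((totalDegree_zero_iff_isHomogeneous _).2 hf)] at hi'
    simp at hi'
  · simp at hd
    rwa [← hd] at hf

lemma eq_sum_of_isHomogeneous_one {n p r : ℕ} [Fact p.Prime] [CharP k p] [Fintype k]
    (hpow : ∀ b : k, (b ^ p ^ r) ^ p ^ r = b) (hn : 2 ≤ n)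
    {f : MvPolynomial (Fin n ⊕ Fin n) k}
    (hf : f ∈ invariantRing (antiHermitianTransvections (p ^ r) n k)) (h1 : f.IsHomogeneous 1) :
    ∃ c : Fin n → k, f = ∑ i, C (c i) * X (Sum.inl i) := by
  have hspan : f ∈ Submodule.span k (Set.range (X : Fin n ⊕ Fin n → MvPolynomial _ k)) := by
    rw [← homogeneousSubmodule_one_eq_span_X]
    exact h1
  obtain ⟨c, rfl⟩ := (Submodule.mem_span_range_iff_exists_fun k).1 hspan
  have hy : ∀ i, c (Sum.inr i) = 0 := by
    intro i
    have : Nontrivial (Fin n) := Fin.nontrivial_iff_two_le.2 hn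
    obtain ⟨j, hij⟩ := exists_ne i
    have := coeff_single_inr_eq_zero hpow hij.symm hf one_pos Fintype.one_lt_card
    simpa [coeff_sum, coeff_X, Finsupp.single_left_inj] using this
  refine ⟨fun i => c (Sum.inl i), ?_⟩
  simp [Fintype.sum_sum_type, hy, smul_eq_C_mul]

lemma not_coregular {n p r : ℕ} [Fact p.Prime] [CharP k p] [Fintype k] (hr : 0 < r)
    (hk : Fintype.card k = (p ^ r) ^ 2) (hpow : ∀ b : k, (b ^ p ^ r) ^ p ^ r = b)
    (hn : 2 ≤ n) :
    ¬ Coregular (antiHermitianTransvections (p ^ r) n k) := by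
  classical
  rintro ⟨F, hFhom, -, hFadj⟩
  have hq : 1 < p ^ r := Nat.one_lt_pow hr.ne' (Fact.out : p.Prime).one_lt
  have hFmem : ∀ i, F i ∈ invariantRing (antiHermitianTransvections (p ^ r) n k) := fun i => by
    rw [← hFadj]
    exact Algebra.subset_adjoin ⟨i, rfl⟩
  let J : Finset (Fin n ⊕ Fin n) := Finset.univ.filter fun i => linearPartX n k (F i) ≠ 0
  have hJmem : ∀ i, i ∈ J ↔ linearPartX n k (F i) ≠ 0 := fun i => by simp [J]
  have hJlin : ∀ i ∈ J, ∃ c : Fin n → k, F i = ∑ s, C (c s) * X (Sum.inl s) := fun i hi => by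
    obtain ⟨d, hd⟩ := hFhom i
    exact eq_sum_of_isHomogeneous_one hpow hn (hFmem i)
      (isHomogeneous_one_of_linearPartX_ne_zero hd ((hJmem i).1 hi))
  have hJrestrict : ∀ i ∈ J, restrictY n k (F i) = 0 := fun i hi => by
    obtain ⟨c, hc⟩ := hJlin i hi
    simp [hc, restrictY]
  have hJcard : n ≤ J.card := by
    have htop : Submodule.span k (J.image fun i => linearPartX n k (F i) : Set (Fin n → k)) =
        ⊤ := by
      rw [eq_top_iff, ← (Pi.basisFun k (Fin n)).span_eq, Submodule.span_le]
      rintro _ ⟨i, rfl⟩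
      have hX := linearPartX_mem_span (hFadj ▸ X_inl_mem_invariantRing i :
        (X (Sum.inl i) : MvPolynomial (Fin n ⊕ Fin n) k) ∈ Algebra.adjoin k (Set.range F))
      rw [linearPartX_X_inl] at hX
      rw [Pi.basisFun_apply]
      refine Submodule.span_le.2 ?_ hX
      rintro _ ⟨s, rfl⟩
      by_cases hs : s ∈ J
      · exact Submodule.subset_span (Finset.mem_coe.2 (Finset.mem_image_of_mem _ hs))
      · have : linearPartX n k (F s) = 0 := by simpa [hJmem] using hs
        simp [this]
    have hle := finrank_span_finset_le_card (R := k) (J.image fun i => linearPartX n k (F i))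
    rw [Set.finrank, htop, finrank_top, Module.finrank_fin_fun] at hle
    exact hle.trans Finset.card_image_le
  let G : {i // i ∉ J} → MvPolynomial (Fin n) k := fun i => restrictY n k (F i)
  have hGadj : ∀ a ∈ invariantRing (antiHermitianTransvections (p ^ r) n k),
      restrictY n k a ∈ Algebra.adjoin k (Set.range G) := fun a ha => by
    rw [← hFadj] at ha
    have hle : Algebra.adjoin k (Set.range F) ≤
        (Algebra.adjoin k (Set.range G)).comap (restrictY n k) := by
      refine Algebra.adjoin_le ?_
      rintro _ ⟨i, rfl⟩
      by_cases hi : i ∈ J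
      · simp [hJrestrict i hi]
      · exact Algebra.subset_adjoin ⟨⟨i, hi⟩, rfl⟩
    exact hle ha
  have hint : ∀ f : MvPolynomial (Fin n) k,
      IsIntegral (Algebra.adjoin k (Set.range G)) f := fun f => by
    induction f using MvPolynomial.induction_on with
    | C a =>
      exact isIntegral_algebraMap
        (x := (⟨C a, Subalgebra.algebraMap_mem _ a⟩ : Algebra.adjoin k (Set.range G)))
    | add f g hf hg => exact hf.add hg
    | mul_X f i hf =>
      refine hf.mul (IsIntegral.of_pow (n := Fintype.card (Fin n → k)) Fintype.card_pos ?_)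
      rw [← restrictY_orbitProduct i]
      exact isIntegral_algebraMap
        (x := (⟨_, hGadj _ (orbitProduct_mem_invariantRing i)⟩ : Algebra.adjoin k (Set.range G)))
  have halg : Algebra.IsAlgebraic (Algebra.adjoin k (Set.range G)) (MvPolynomial (Fin n) k) :=
    ⟨fun f => (hint f).isAlgebraic⟩
  have hGind : AlgebraicIndependent k G := by
    refine (Algebra.IsAlgebraic.isTranscendenceBasis_of_le_trdeg_of_finite k G ?_).1
    rw [MvPolynomial.trdeg_of_isDomain, Cardinal.lift_id, Cardinal.mk_fin, Cardinal.mk_fintype,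
      Nat.cast_le, Fintype.card_subtype_compl, Fintype.card_sum, Fintype.card_fin,
      Fintype.card_coe]
    omega
  let τ : MvPolynomial (Fin n ⊕ Fin n) k →ₐ[k] MvPolynomial {i // i ∉ J} k :=
    aeval fun i => if h : i ∈ J then 0 else X ⟨i, h⟩
  have hτ : ∀ P, aeval G (τ P) = restrictY n k (aeval F P) := fun P => by
    have : (aeval G).comp τ = (restrictY n k).comp (aeval F) := by
      refine MvPolynomial.algHom_ext fun i => ?_
      by_cases hi : i ∈ J
      · simp [τ, hi, hJrestrict i hi]
      · simp [τ, hi, G]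
    exact DFunLike.congr_fun this P
  have hdiff : ∀ P : MvPolynomial (Fin n ⊕ Fin n) k, ∃ h : Fin n → MvPolynomial (Fin n ⊕ Fin n) k,
      (∀ s, h s ∈ invariantRing (antiHermitianTransvections (p ^ r) n k)) ∧
      aeval F P - aeval (fun i : {i // i ∉ J} => F i) (τ P) = ∑ s, X (Sum.inl s) * h s :=
      fun P => by
    induction P using MvPolynomial.induction_on with
    | C a => exact ⟨0, fun s => Subalgebra.zero_mem _, by simp [algHom_C]⟩
    | add P Q hP hQ =>
      obtain ⟨h, hh, hh'⟩ := hP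
      obtain ⟨g, hg, hg'⟩ := hQ
      refine ⟨h + g, fun s => Subalgebra.add_mem _ (hh s) (hg s), ?_⟩
      simp only [map_add, Pi.add_apply, mul_add, Finset.sum_add_distrib, ← hh', ← hg']
      ring
    | mul_X P i hP =>
      by_cases hi : i ∈ J
      · obtain ⟨c, hc⟩ := hJlin i hi
        refine ⟨fun s => aeval F P * C (c s), fun s => Subalgebra.mul_mem _ ?_
          (Subalgebra.algebraMap_mem _ _), ?_⟩
        · rw [← hFadj, Algebra.adjoin_range_eq_range_aeval]
          exact ⟨P, rfl⟩
        · rw [map_mul, map_mul, aeval_X, show τ (X i) = 0 by simp [τ, hi], mul_zero, map_zero,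
            sub_zero, hc, Finset.mul_sum]
          exact Finset.sum_congr rfl fun s _ => by ring
      · obtain ⟨h, hh, hh'⟩ := hP
        refine ⟨fun s => h s * F i, fun s => Subalgebra.mul_mem _ (hh s) (hFmem i), ?_⟩
        rw [map_mul, map_mul, map_mul, aeval_X, show τ (X i) = X ⟨i, hi⟩ by simp [τ, hi], aeval_X,
          ← sub_mul, hh', Finset.sum_mul]
        exact Finset.sum_congr rfl fun s _ => by ring
  obtain ⟨P, hP⟩ : ∃ P, aeval F P = hermitianForm n k (p ^ r) := by
    have : hermitianForm n k (p ^ r) ∈ Algebra.adjoin k (Set.range F) :=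
      hFadj ▸ hermitianForm_mem_invariantRing
    rw [Algebra.adjoin_range_eq_range_aeval] at this
    exact this
  have hτP : τ P = 0 := by
    refine hGind (a₂ := 0) ?_
    rw [map_zero, hτ, hP]
    simp [hermitianForm, restrictY]
  obtain ⟨h, hh, hh'⟩ := hdiff P
  rw [hτP, map_zero, sub_zero, hP] at hh'
  have hij : (⟨0, by omega⟩ : Fin n) ≠ ⟨1, by omega⟩ := by simp
  have hcoeff := coeff_hermitianForm (k := k) hq (⟨0, by omega⟩ : Fin n)
  rw [hh'] at hcoeff
  simp only [coeff_sum, coeff_X_inl_mul, Finset.sum_ite_eq', Finset.mem_univ, if_true] at hcoeff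
  rw [coeff_single_inr_eq_zero hpow hij (hh _) (by omega) (by rw [hk]; nlinarith)] at hcoeff
  exact zero_ne_one hcoeff

/-- The action of the unitary transvection group `G_n` on `V = k^{2n}`,
`k = F_{q²}`, `n ≥ 2`, is not coregular and does not have the direct summand
property. -/
theorem antiHermitianTransvections_not_coregular_not_directSummand
    (p r n : ℕ) [Fact p.Prime] (hr : 0 < r) (q : ℕ) (hq : q = p ^ r) (hn : 2 ≤ n)
    (k : Type) [Field k] [Fintype k] (hk : Fintype.card k = q ^ 2) :
    ¬ Coregular (antiHermitianTransvections q n k) ∧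
      ¬ DirectSummand (antiHermitianTransvections q n k) := by
  subst hq
  have hcard : Fintype.card k = p ^ (r * 2) := by rw [hk, pow_mul]
  have : CharP k p := charP_of_card_eq_prime_pow hcard
  have hpow : ∀ b : k, (b ^ p ^ r) ^ p ^ r = b := fun b => by
    rw [← pow_mul, ← sq, ← hk, FiniteField.pow_card]
  have hij : (⟨0, by omega⟩ : Fin n) ≠ ⟨1, by omega⟩ := by simp
  exact ⟨not_coregular hr hk hpow hn, not_directSummand hr hk hpow hij⟩
end

section
/- Let k = F_{q²}, V = k³ with coordinate functions x₁,x₂,x₃, and let H̃ ≤ GL₃(k) be the group of matrices [[1,0,0],[a,1,0],[c,-a^q,1]] with a,c ∈ k satisfying c + c^q + a^{q+1} = 0. Let η ∈ k be a primitive (q+1)-st root of unity and τ = diag(1, η^{-1}, 1). Set h = x₂(x₂^{q²-1} - x₁^{q²-1}) ∈ k[V]. Then h is H̃-invariant with τ·h = η·h, and every H̃-invariant polynomial f ∈ k[V]^{H̃} satisfying τ·f = η·f is divisible by h in k[V]. -/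
open MvPolynomial Matrix

set_option synthInstance.maxHeartbeats 1000000
set_option maxHeartbeats 1000000

variable {k : Type} [Field k] {ι : Type} [Fintype ι] [DecidableEq ι]

/-- The point stabilizer `H̃` of `⟨e₃⟩` in `SU₃(q)`: matrices
`[[1,0,0],[a,1,0],[c,-a^q,1]]` with `c + c^q + a^{q+1} = 0`. -/
def HtildeSet (q : ℕ) (k : Type) [Field k] : Set (Matrix (Fin 3) (Fin 3) k) :=
  {M | ∃ a c : k, c + c ^ q + a ^ (q + 1) = 0 ∧
    M = !![1, 0, 0; a, 1, 0; c, -(a ^ q), 1]}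

/-- The diagonal matrix `τ = diag(1, η⁻¹, 1)`. -/
def tauMat (k : Type) [Field k] (η : k) : Matrix (Fin 3) (Fin 3) k :=
  !![1, 0, 0; 0, η⁻¹, 0; 0, 0, 1]

/-- The polynomial `h = x₂ (x₂^{q²-1} - x₁^{q²-1})`. -/
noncomputable def hPoly (q : ℕ) (k : Type) [Field k] : MvPolynomial (Fin 3) k :=
  X 1 * (X 1 ^ (q ^ 2 - 1) - X 0 ^ (q ^ 2 - 1))

lemma inv_Htilde_mat {K : Type} [Field K] (a b c : K) :
    (!![1, 0, 0; a, 1, 0; c, -b, 1] : Matrix (Fin 3) (Fin 3) K)⁻¹ =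
      !![1, 0, 0; -a, 1, 0; -c - a * b, b, 1] := by
  apply Matrix.inv_eq_right_inv
  ext i j
  fin_cases i <;> fin_cases j <;> simp [Matrix.mul_apply, Fin.sum_univ_three]
  ring

lemma inv_tauMat {K : Type} [Field K] {η : K} (hη : η ≠ 0) :
    (tauMat K η)⁻¹ = !![1, 0, 0; 0, η, 0; 0, 0, 1] := by
  apply Matrix.inv_eq_right_inv
  ext i j
  fin_cases i <;> fin_cases j <;> simp [tauMat, Matrix.mul_apply, Fin.sum_univ_three, hη]

lemma polyAct_Htilde_X_zero {K : Type} [Field K] (a b c : K) :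
    polyAct !![1, 0, 0; a, 1, 0; c, -b, 1] (X 0) = X 0 := by
  simp [polyAct, polySub, inv_Htilde_mat, Fin.sum_univ_three]

lemma polyAct_Htilde_X_one {K : Type} [Field K] (a b c : K) :
    polyAct !![1, 0, 0; a, 1, 0; c, -b, 1] (X 1) = X 1 - C a * X 0 := by
  simp [polyAct, polySub, inv_Htilde_mat, Fin.sum_univ_three]
  ring

lemma polyAct_tauMat_X {K : Type} [Field K] {η : K} (hη : η ≠ 0) (i : Fin 3) :
    polyAct (tauMat K η) (X i) = C (if i = 1 then η else 1) * X i := by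
  fin_cases i <;> simp [polyAct, polySub, inv_tauMat hη, Fin.sum_univ_three]

/-- The homogeneous form of `∏ a, (T - a) = T ^ |K| - T` over a finite field `K`. -/
lemma FiniteField.prod_sub_algebraMap_mul {K L : Type*} [Field K] [Fintype K] [Field L]
    [Algebra K L] (y z : L) (hz : z ≠ 0) :
    ∏ a : K, (y - algebraMap K L a * z) =
      y ^ Fintype.card K - y * z ^ (Fintype.card K - 1) := by
  have hcard : 1 < Fintype.card K := Fintype.one_lt_card
  have hprod : ∏ a : K, (Polynomial.X - Polynomial.C a) =
      Polynomial.X ^ Fintype.card K - Polynomial.X := by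
    have hroots := FiniteField.roots_X_pow_card_sub_X K
    have h := Polynomial.prod_multiset_X_sub_C_of_monic_of_roots_card_eq
      (p := (Polynomial.X ^ Fintype.card K - Polynomial.X : Polynomial K))
      (Polynomial.monic_X_pow_sub (by simpa using hcard))
      (by rw [hroots, FiniteField.X_pow_card_sub_X_natDegree_eq K hcard]; rfl)
    rw [hroots] at h
    exact h
  have h := congrArg (Polynomial.aeval (y / z)) hprod
  simp only [map_prod, map_sub, Polynomial.aeval_X, Polynomial.aeval_C, map_pow] at h
  have hfactor : ∀ a : K, y - algebraMap K L a * z = z * (y / z - algebraMap K L a) := by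
    intro a
    field_simp
  rw [Finset.prod_congr rfl fun a _ => hfactor a, Finset.prod_mul_distrib, h,
    Finset.prod_const, Finset.card_univ]
  obtain ⟨n, hn⟩ : ∃ n, Fintype.card K = n + 1 := ⟨Fintype.card K - 1, by omega⟩
  rw [hn, Nat.add_sub_cancel, div_pow]
  field_simp
  ring

lemma hPoly_eq_prod {q : ℕ} {K : Type} [Field K] [Fintype K] (hK : Fintype.card K = q ^ 2) :
    hPoly q K = ∏ a : K, (X 1 - C a * X 0) := by
  apply IsFractionRing.injective (MvPolynomial (Fin 3) K) (FractionRing (MvPolynomial (Fin 3) K))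
  have hX : algebraMap (MvPolynomial (Fin 3) K) (FractionRing (MvPolynomial (Fin 3) K)) (X 0) ≠ 0 :=
    by simp
  have h := FiniteField.prod_sub_algebraMap_mul (K := K)
    (algebraMap (MvPolynomial (Fin 3) K) (FractionRing (MvPolynomial (Fin 3) K)) (X 1)) _ hX
  have hpos : 0 < q ^ 2 := hK ▸ Fintype.card_pos
  simp only [IsScalarTower.algebraMap_apply K (MvPolynomial (Fin 3) K)
    (FractionRing (MvPolynomial (Fin 3) K)), MvPolynomial.algebraMap_eq] at h
  simp only [map_prod, map_sub, map_mul]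
  rw [h, hPoly, hK, mul_sub, mul_pow_sub_one hpos.ne']
  simp

lemma isRelPrime_X_sub_C_mul_X {K σ : Type*} [Field K] {i j : σ} (hij : i ≠ j) {a b : K}
    (hab : a ≠ b) : IsRelPrime (X i - C a * X j : MvPolynomial σ K) (X i - C b * X j) := by
  intro d ha hb
  have hX : IsRelPrime (X j : MvPolynomial σ K) (X i) :=
    ((MvPolynomial.X_prime (i := j)).irreducible.isRelPrime_iff_not_dvd).2
      (by rw [MvPolynomial.X_dvd_X]; exact hij.symm)
  have hj : d ∣ X j := by
    have h : d ∣ C (b - a)⁻¹ * ((X i - C a * X j) - (X i - C b * X j)) :=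
      (dvd_sub ha hb).mul_left _
    have hC : C (b - a)⁻¹ * (C b - C a) = (1 : MvPolynomial σ K) := by
      rw [← C_sub, ← C_mul, inv_mul_cancel₀ (sub_ne_zero.2 hab.symm), C_1]
    convert h using 1
    linear_combination (-X j) * hC
  refine hX hj ?_
  simpa using dvd_add ha (hj.mul_left (C a))

/-- A semi-invariant of `τ` of nontrivial weight is divisible by `x₂`. -/
lemma X_one_dvd_of_polyAct_tauMat {K : Type} [Field K] {η : K} (h0 : η ≠ 0) (h1 : η ≠ 1)
    {f : MvPolynomial (Fin 3) K} (hf : polyAct (tauMat K η) f = η • f) : X 1 ∣ f := by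
  rw [← Ideal.mem_span_singleton, ← Ideal.Quotient.eq_zero_iff_mem]
  let π := Ideal.Quotient.mkₐ K (Ideal.span {(X 1 : MvPolynomial (Fin 3) K)})
  have hπX : π (X 1) = 0 :=
    Ideal.Quotient.eq_zero_iff_mem.2 (Ideal.mem_span_singleton_self _)
  have hπ : π.comp (polyAct (tauMat K η)) = π := by
    apply MvPolynomial.algHom_ext
    intro i
    rw [AlgHom.comp_apply, polyAct_tauMat_X h0]
    by_cases hi : i = 1
    · subst hi
      rw [map_mul, hπX, mul_zero]
    · simp [hi]
  have h : π f = η • π f := by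
    rw [← map_smul, ← hf]
    exact (DFunLike.congr_fun hπ f).symm
  have h' : (1 - η) • π f = 0 := by rw [sub_smul, one_smul, ← h, sub_self]
  exact (smul_eq_zero.1 h').resolve_left (sub_ne_zero.2 h1.symm)

/-- The trace of a quadratic extension of finite fields is surjective. -/
lemma exists_add_pow_eq {p r q : ℕ} [Fact p.Prime] (hq : q = p ^ r) {K : Type} [Field K]
    [CharP K p] {η : K} (hη : η ^ (q + 1) = 1) (h1 : η ≠ 1)
    (hfrob : ∀ x : K, x ^ (q ^ 2) = x) {b : K} (hb : b ^ q = b) :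
    ∃ c : K, c + c ^ q = b := by
  have hadd : ∀ x y : K, (x + y) ^ q = x ^ q + y ^ q := fun x y => by
    rw [hq, add_pow_char_pow]
  obtain ⟨c, hc⟩ : ∃ c : K, c + c ^ q ≠ 0 := by
    by_contra! h
    have hone : (1 : K) + 1 = 0 := by simpa using h 1
    have hsq : (η - 1) ^ 2 = 0 := by
      linear_combination η * h η - hη - η * hone
    exact h1 (sub_eq_zero.1 (pow_eq_zero_iff two_ne_zero |>.1 hsq))
  have hcq : (c + c ^ q) ^ q = c + c ^ q := by
    rw [hadd, ← pow_mul, ← sq, hfrob, add_comm]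
  refine ⟨c * (b / (c + c ^ q)), ?_⟩
  rw [mul_pow, div_pow, hb, hcq, ← add_mul, mul_div_cancel₀ _ hc]

/-- The polynomial `h = x₂(x₂^{q²-1} - x₁^{q²-1})` is `H̃`-invariant, is an
`η`-semi-invariant for `τ`, and divides every `H̃`-invariant `η`-semi-invariant
for `τ`. -/
theorem hPoly_semiinvariant_and_divides
    (p r : ℕ) [Fact p.Prime] (hr : 0 < r) (q : ℕ) (hq : q = p ^ r)
    (k : Type) [Field k] [Fintype k] (hk : Fintype.card k = q ^ 2)
    (η : k) (hη : IsPrimitiveRoot η (q + 1)) :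
    (∀ M ∈ HtildeSet q k, polyAct M (hPoly q k) = hPoly q k) ∧
    polyAct (tauMat k η) (hPoly q k) = η • hPoly q k ∧
    ∀ f : MvPolynomial (Fin 3) k,
      (∀ M ∈ HtildeSet q k, polyAct M f = f) →
      polyAct (tauMat k η) f = η • f →
      hPoly q k ∣ f := by
  have hp : p.Prime := Fact.out
  have hq1 : 1 < q := hq ▸ Nat.one_lt_pow hr.ne' hp.one_lt
  have h0 : η ≠ 0 := hη.ne_zero (by omega)
  have h1 : η ≠ 1 := hη.ne_one (by omega)
  have hfrob : ∀ x : k, x ^ (q ^ 2) = x := fun x => hk ▸ FiniteField.pow_card x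
  have : CharP k p := charP_of_card_eq_prime_pow (f := r * 2) (by rw [hk, hq, pow_mul])
  refine ⟨?_, ?_, ?_⟩
  · rintro M ⟨a, c, -, rfl⟩
    rw [hPoly_eq_prod hk, map_prod]
    refine Fintype.prod_equiv (Equiv.addRight a) _ _ fun b => ?_
    rw [map_sub, map_mul, polyAct_Htilde_X_zero, polyAct_Htilde_X_one, ← algebraMap_eq,
      AlgHom.commutes, algebraMap_eq, Equiv.coe_addRight, C_add]
    ring
  · have hη' : η ^ (q ^ 2 - 1) = 1 := by
      refine mul_left_cancel₀ h0 ?_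
      rw [mul_pow_sub_one (by positivity), hfrob, mul_one]
    simp only [hPoly, map_mul, map_sub, map_pow, polyAct_tauMat_X h0, mul_pow, smul_eq_C_mul]
    simp [← C_pow, hη', mul_assoc]
  · intro f hf hτ
    have hX : X 1 ∣ f := X_one_dvd_of_polyAct_tauMat h0 h1 hτ
    rw [hPoly_eq_prod hk]
    refine Fintype.prod_dvd_of_isRelPrime
      (fun a b hab => isRelPrime_X_sub_C_mul_X one_ne_zero hab) fun a => ?_
    have hb : (-a ^ (q + 1)) ^ q = -a ^ (q + 1) := by
      have hneg : ∀ x : k, (-x) ^ q = -x ^ q := fun x => by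
        have h := sub_pow_char_pow (p := p) (n := r) (0 : k) x
        rw [← hq, zero_pow (by omega)] at h
        simpa using h
      rw [hneg, ← pow_mul, add_mul, one_mul, ← sq, pow_add, hfrob, pow_succ, mul_comm]
    obtain ⟨c, hc⟩ := exists_add_pow_eq hq hη.pow_eq_one h1 hfrob hb
    have hM := hf _ ⟨a, c, by rw [hc, neg_add_cancel], rfl⟩
    rw [← hM, ← polyAct_Htilde_X_one a (a ^ q) c]
    exact map_dvd _ hX
end
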